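/- Let G be a real Gaussian random variable with mean 0 and variance ε > 0, and let s > 0 (a lower volatility bound), k ∈ ℝ and λ > 0. Then the Chebyshev-type lower bound E[ (e^{−½εs² + sG} − e^k)⁺ ] ≥ λ·N( −½s√ε − ln(e^k+λ)/(s√ε) ) holds, where N is the standard normal cumulative distribution function. -/

import Mathlib

open MeasureTheory Set Filter ProbabilityTheory

noncomputable section

/-- The standard normal cumulative distribution function
`N(x) = (2π)^{-1/2} ∫_{-∞}^x e^{-y²/2} dy`. -/
noncomputable def stdNormalCDF (x : ℝ) : ℝ :=
  (Real.sqrt (2 * Real.pi))⁻¹ * ∫ y in Set.Iio x, Real.exp (-(y ^ 2) / 2)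

lemma stdNormalCDF_eq_gaussianReal_Iio (x : ℝ) :
    stdNormalCDF x = (gaussianReal 0 1).real (Iio x) := by
  rw [measureReal_def, gaussianReal_apply_eq_integral 0 one_ne_zero,
    ENNReal.toReal_ofReal (integral_nonneg fun y ↦ gaussianPDFReal_nonneg 0 1 y), stdNormalCDF,
    ← integral_const_mul]
  simp [gaussianPDFReal]

/-- The centered Gaussian law with variance `v` is the law of `-√v Z` for a standard normal `Z`. -/
lemma map_neg_sqrt_mul_gaussianReal {v : ℝ} (hv : 0 ≤ v) :
    (gaussianReal 0 1).map (fun z ↦ -√v * z) = gaussianReal 0 v.toNNReal := by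
  rw [gaussianReal_map_const_mul]
  congr 1
  · simp
  · ext
    simp [Real.sq_sqrt hv, hv]

/-- The call payoff is integrable under any Gaussian law. -/
lemma integrable_call_payoff_gaussianReal (m : ℝ) (v : NNReal) (a s K : ℝ) :
    Integrable (fun g ↦ max (Real.exp (a + s * g) - K) 0) (gaussianReal m v) := by
  simp only [Real.exp_add]
  exact (((integrable_exp_mul_gaussianReal s).const_mul _).sub (integrable_const K)).pos_part

/-- If `G` is a centered real Gaussian with variance `ε > 0`, `s > 0`,
`k ∈ ℝ` and `λ > 0`, then
`E[(e^{−½εs² + sG} − e^k)⁺] ≥ λ · N(−½s√ε − ln(e^k+λ)/(s√ε))`. -/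
theorem gaussian_call_lower_bound (ε s k lam : ℝ) (hε : 0 < ε) (hs : 0 < s) (hlam : 0 < lam) :
    lam * stdNormalCDF (-(1 / 2) * s * Real.sqrt ε
        - Real.log (Real.exp k + lam) / (s * Real.sqrt ε))
      ≤ ∫ g, max (Real.exp (-(1 / 2) * ε * s ^ 2 + s * g) - Real.exp k) 0
          ∂(gaussianReal 0 ε.toNNReal) := by
  set x := -(1 / 2) * s * √ε - Real.log (Real.exp k + lam) / (s * √ε) with hx
  set f : ℝ → ℝ := fun g ↦ max (Real.exp (-(1 / 2) * ε * s ^ 2 + s * g) - Real.exp k) 0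
  have hfint : Integrable f (gaussianReal 0 ε.toNNReal) :=
    integrable_call_payoff_gaussianReal 0 _ _ s (Real.exp k)
  have hsub : Iio x ⊆ {z | lam ≤ f (-√ε * z)} := by
    intro z hz
    have hsε : 0 < s * √ε := mul_pos hs (Real.sqrt_pos.2 hε)
    have hlog : Real.log (Real.exp k + lam) ≤ -(1 / 2) * ε * s ^ 2 + s * (-√ε * z) := by
      have hlt : z * (s * √ε) < x * (s * √ε) := mul_lt_mul_of_pos_right hz hsε
      have hxs : x * (s * √ε) = -(1 / 2) * ε * s ^ 2 - Real.log (Real.exp k + lam) := by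
        rw [hx, sub_mul, div_mul_cancel₀ _ hsε.ne']
        linear_combination (-(1 / 2) * s ^ 2) * Real.sq_sqrt hε.le
      linarith
    have hexp := (Real.log_le_iff_le_exp (add_pos (Real.exp_pos k) hlam)).1 hlog
    exact le_max_of_le_left (le_sub_iff_add_le'.2 hexp)
  have hmeas : AEMeasurable (fun z ↦ -√ε * z) (gaussianReal 0 1) := by fun_prop
  rw [← map_neg_sqrt_mul_gaussianReal hε.le] at hfint ⊢
  rw [stdNormalCDF_eq_gaussianReal_Iio, integral_map hmeas hfint.aestronglyMeasurable]
  calc lam * (gaussianReal 0 1).real (Iio x)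
      ≤ lam * (gaussianReal 0 1).real {z | lam ≤ f (-√ε * z)} := by gcongr; finiteness
    _ ≤ ∫ z, f (-√ε * z) ∂gaussianReal 0 1 :=
        mul_meas_ge_le_integral_of_nonneg (ae_of_all _ fun _ ↦ le_max_right _ _)
          (hfint.comp_aemeasurable hmeas) lam

end
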